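/- Let D be a p-subgroup of the finite group G with |D| = p^d, and let m : {0, 1, …, d} → ℕ be a function such that for every k ∈ {0,…,d} and every subgroup Q ≤ D of order p^k one has J(F·Z(Q))^{m(k)} = 0, where Z(Q) is the center of Q. Then I_{≤D}(G) · J(Z(FG))^{m(0) + m(1) + … + m(d)} = 0. -/

import Mathlib

set_option synthInstance.maxHeartbeats 1000000
set_option maxHeartbeats 1000000

open scoped Classical

/-- The class sum `K⁺ = ∑_{x ∈ K} x` of a conjugacy class `K` in the group algebra `FG`. -/
noncomputable def classSum (F : Type) [Field F] {G : Type} [Group G] [Fintype G]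
    (K : ConjClasses G) : MonoidAlgebra F G :=
  ∑ x : G, if x ∈ K.carrier then MonoidAlgebra.single x (1 : F) else 0

/-- `P` is a defect group of the conjugacy class `K`: `P` is a Sylow `p`-subgroup of the
centralizer of some element of `K`. -/
def IsClassDefectGroup {G : Type} [Group G] (p : ℕ) (P : Subgroup G) (K : ConjClasses G) : Prop :=
  ∃ x ∈ K.carrier, ∃ S : Sylow p ↥(Subgroup.centralizer {x}),
    P = Subgroup.map (Subgroup.centralizer {x}).subtype S.toSubgroup

/-- `I_P(G)`: the `F`-span of the class sums of conjugacy classes with defect group `P`. -/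
noncomputable def classIdeal (F : Type) [Field F] {G : Type} [Group G] [Fintype G]
    (p : ℕ) (P : Subgroup G) : Submodule F (MonoidAlgebra F G) :=
  Submodule.span F {a | ∃ K : ConjClasses G, IsClassDefectGroup p P K ∧ a = classSum F K}

/-- `I_{≤P}(G) = ∑_{Q ≤ P} I_Q(G)`. -/
noncomputable def classIdealLE (F : Type) [Field F] {G : Type} [Group G] [Fintype G]
    (p : ℕ) (P : Subgroup G) : Submodule F (MonoidAlgebra F G) :=
  ⨆ Q ≤ P, classIdeal F p Q

/-- `I_{<P}(G) = ∑_{Q < P} I_Q(G)`. -/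
noncomputable def classIdealLT (F : Type) [Field F] {G : Type} [Group G] [Fintype G]
    (p : ℕ) (P : Subgroup G) : Submodule F (MonoidAlgebra F G) :=
  ⨆ Q < P, classIdeal F p Q

/-- The Jacobson radical `J(Z(FG))` of the center of the group algebra, viewed as an
`F`-submodule of `FG`. -/
noncomputable def JZ (F : Type) [Field F] (G : Type) [Group G] [Fintype G] :
    Submodule F (MonoidAlgebra F G) :=
  Submodule.map (Subalgebra.center F (MonoidAlgebra F G)).val.toLinearMap
    ((Ideal.jacobson (⊥ : Ideal ↥(Subalgebra.center F (MonoidAlgebra F G)))).restrictScalars F)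

/-- The element of the group algebra of a finite group with prescribed coefficients. -/
noncomputable def MonoidAlgebra.ofFun {F : Type} [Field F] {G : Type} [Fintype G] (f : G → F) :
    MonoidAlgebra F G :=
  MonoidAlgebra.ofCoeff (Finsupp.equivFunOnFinite.symm f)

@[simp]
lemma MonoidAlgebra.coeff_ofFun {F : Type} [Field F] {G : Type} [Fintype G]
    (f : G → F) (x : G) : (MonoidAlgebra.ofFun f).coeff x = f x := rfl

lemma MonoidAlgebra.coeff_mul_eq_sum {F : Type} [Field F] {G : Type} [Group G] [Fintype G]
    (a b : MonoidAlgebra F G) (y : G) :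
    (a * b).coeff y = ∑ u, a.coeff u * b.coeff (u⁻¹ * y) := by
  rw [MonoidAlgebra.coeff_mul_apply_left, Finsupp.sum_fintype _ _ (by simp)]

lemma MonoidAlgebra.eq_sum_single {F : Type} [Field F] {G : Type} [Fintype G]
    (a : MonoidAlgebra F G) :
    a = ∑ x, MonoidAlgebra.single x (a.coeff x) := by
  conv_lhs => rw [← MonoidAlgebra.sum_coeff_single a]
  rw [Finsupp.sum_fintype _ _ (by simp)]

lemma MonoidAlgebra.mem_center_iff_coeff {F : Type} [Field F] {G : Type} [Group G] [Fintype G]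
    (a : MonoidAlgebra F G) :
    a ∈ Subalgebra.center F (MonoidAlgebra F G) ↔
      ∀ g x, a.coeff (g * x * g⁻¹) = a.coeff x := by
  rw [Subalgebra.mem_center_iff]
  constructor
  · intro h g x
    have := congrArg (fun b => b.coeff (g * x)) (h (MonoidAlgebra.single g 1))
    simpa using this.symm
  · intro h b
    ext y
    rw [MonoidAlgebra.eq_sum_single b, Finset.sum_mul, Finset.mul_sum]
    simp only [MonoidAlgebra.coeff_sum, Finsupp.finsetSum_apply]
    refine Finset.sum_congr rfl fun g _ => ?_
    rw [MonoidAlgebra.coeff_single_mul_apply, MonoidAlgebra.coeff_mul_single_apply, mul_comm,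
      ← h g (g⁻¹ * y)]
    congr 2
    group

/-- The central elements of the group algebra whose support is contained in `S`. -/
noncomputable def centralSupp (F : Type) [Field F] {G : Type} [Group G] [Fintype G] (S : Set G) :
    Submodule F (MonoidAlgebra F G) where
  carrier := {a | a ∈ Subalgebra.center F (MonoidAlgebra F G) ∧ ∀ x, a.coeff x ≠ 0 → x ∈ S}
  zero_mem' := ⟨zero_mem _, by simp⟩
  add_mem' := by
    rintro a b ⟨ha, ha'⟩ ⟨hb, hb'⟩
    refine ⟨add_mem ha hb, fun x hx => ?_⟩
    by_cases h : a.coeff x = 0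
    · exact hb' x (by simpa [h] using hx)
    · exact ha' x h
  smul_mem' := by
    rintro c a ⟨ha, ha'⟩
    refine ⟨Subalgebra.smul_mem _ ha c, fun x hx => ha' x fun h => hx ?_⟩
    simp [h]

lemma coeff_classSum {F : Type} [Field F] {G : Type} [Group G] [Fintype G]
    (K : ConjClasses G) (x : G) :
    (classSum F K).coeff x = if x ∈ K.carrier then 1 else 0 := by
  unfold classSum
  simp only [MonoidAlgebra.coeff_sum, Finsupp.finsetSum_apply]
  rw [Finset.sum_eq_single x]
  · split_ifs <;> simp
  · intro b _ hb
    split_ifs <;> simp [hb]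
  · simp

lemma ConjClasses.mk_conj {G : Type} [Group G] (g x : G) :
    ConjClasses.mk (g * x * g⁻¹) = ConjClasses.mk x :=
  ConjClasses.mk_eq_mk_iff_isConj.2 (isConj_iff.2 ⟨g, rfl⟩).symm

/-- Sums of the spans `I_R(G)` are described by support conditions on central elements. -/
lemma iSup_classIdeal_eq_centralSupp {F : Type} [Field F] {G : Type} [Group G] [Fintype G]
    (p : ℕ) (P : Subgroup G → Prop) :
    ⨆ R, ⨆ _ : P R, classIdeal F p R =
      centralSupp F {x | ∃ R, P R ∧ IsClassDefectGroup p R (ConjClasses.mk x)} := by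
  apply le_antisymm
  · refine iSup₂_le fun R hR => Submodule.span_le.2 ?_
    rintro _ ⟨K, hK, rfl⟩
    refine ⟨(MonoidAlgebra.mem_center_iff_coeff _).2 fun g x => ?_, fun x hx => ?_⟩
    · simp only [coeff_classSum, ConjClasses.mem_carrier_iff_mk_eq, ConjClasses.mk_conj]
    · rw [coeff_classSum, ConjClasses.mem_carrier_iff_mk_eq] at hx
      refine ⟨R, hR, ?_⟩
      by_cases h : ConjClasses.mk x = K
      · rwa [h]
      · simp [h] at hx
  · rintro a ⟨ha, ha'⟩
    rw [MonoidAlgebra.mem_center_iff_coeff] at ha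
    have hsum : a = ∑ K : ConjClasses G, a.coeff (Quotient.out K) • classSum F K := by
      ext x
      simp only [MonoidAlgebra.coeff_sum, Finsupp.finsetSum_apply, MonoidAlgebra.coeff_smul,
        Finsupp.smul_apply, coeff_classSum, ConjClasses.mem_carrier_iff_mk_eq, smul_eq_mul,
        mul_ite, mul_one, mul_zero]
      rw [Finset.sum_ite_eq]
      simp only [Finset.mem_univ, if_true]
      have hc : IsConj x (Quotient.out (ConjClasses.mk x)) :=
        ConjClasses.mk_eq_mk_iff_isConj.1 (Quotient.out_eq (ConjClasses.mk x)).symm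
      obtain ⟨g, hg⟩ := isConj_iff.1 hc
      rw [← hg, ha]
    rw [hsum]
    refine Submodule.sum_mem _ fun K _ => ?_
    by_cases h : a.coeff (Quotient.out K) = 0
    · simp [h]
    · obtain ⟨R, hR, hK⟩ := ha' _ h
      rw [show ConjClasses.mk (Quotient.out K) = K from Quotient.out_eq K] at hK
      exact Submodule.smul_mem _ _
        (Submodule.mem_iSup_of_mem R (Submodule.mem_iSup_of_mem hR
          (Submodule.subset_span ⟨K, hK, rfl⟩)))

/-- In characteristic `p`, the sum of a function invariant under a `p`-group only sees fixed
points. -/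
lemma IsPGroup.sum_eq_sum_fixedPoints {F : Type} [Field F] {p : ℕ} [Fact p.Prime] [CharP F p]
    {P α : Type} [Group P]
    [Finite P] [MulAction P α] [Fintype α] (hP : IsPGroup p P) (f : α → F)
    (hf : ∀ (g : P) a, f (g • a) = f a) :
    ∑ a, f a = ∑ a, if a ∈ MulAction.fixedPoints P α then f a else 0 := by
  have key : ∑ a ∈ Finset.univ.filter (fun a => a ∉ MulAction.fixedPoints P α), f a = 0 := by
    rw [← Finset.sum_fiberwise_of_maps_to (t := Finset.univ.image f)
      (fun a _ => Finset.mem_image_of_mem f (Finset.mem_univ a))]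
    refine Finset.sum_eq_zero fun v _ => ?_
    rw [Finset.sum_congr rfl (g := fun _ => v) (by simp), Finset.sum_const]
    let T : SubMulAction P α :=
      { carrier := {a | a ∉ MulAction.fixedPoints P α ∧ f a = v}
        smul_mem' := by
          rintro g a ⟨h1, h2⟩
          refine ⟨fun h => h1 fun k => ?_, by rw [hf, h2]⟩
          have h3 : ∀ k : P, k • g • a = g • a := h
          have h4 : g • a = a := by
            have := h3 g⁻¹
            rwa [inv_smul_smul, eq_comm] at this
          rw [← h4, h3 k] }
    have hT := hP.card_modEq_card_fixedPoints T
    have h0 : Nat.card (MulAction.fixedPoints P T) = 0 := by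
      have : IsEmpty (MulAction.fixedPoints P T) := by
        refine ⟨fun ⟨⟨a, h1, h2⟩, h3⟩ => h1 fun g => ?_⟩
        exact congrArg Subtype.val (h3 g)
      simp
    rw [h0] at hT
    have hcard : (Finset.filter (fun a => f a = v)
        (Finset.univ.filter (fun a => a ∉ MulAction.fixedPoints P α))).card = Nat.card T := by
      rw [Finset.filter_filter, ← Fintype.card_subtype, ← Nat.card_eq_fintype_card]
      rfl
    rw [hcard, nsmul_eq_mul, (CharP.cast_eq_zero_iff F p _).2 ((Nat.modEq_zero_iff_dvd).1 hT),
      zero_mul]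
  rw [← Finset.sum_filter_add_sum_filter_not Finset.univ
    (fun a => a ∈ MulAction.fixedPoints P α), key, add_zero, Finset.sum_filter]

/-- The Brauer map is multiplicative: on elements centralized by a `p`-subgroup `R`, the
coefficients of a product of central elements can be computed inside `C_G(R)`. -/
lemma coeff_mul_eq_sum_centralizer {F : Type} [Field F] {G : Type} [Group G] [Fintype G]
    {p : ℕ} [Fact p.Prime] [CharP F p] {R : Subgroup G}
    (hR : IsPGroup p R) {a b : MonoidAlgebra F G}
    (ha : a ∈ Subalgebra.center F (MonoidAlgebra F G))
    (hb : b ∈ Subalgebra.center F (MonoidAlgebra F G)) {y : G}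
    (hy : y ∈ Subgroup.centralizer (R : Set G)) :
    (a * b).coeff y = ∑ u : Subgroup.centralizer (R : Set G),
      a.coeff u * b.coeff ((u : G)⁻¹ * y) := by
  rw [MonoidAlgebra.mem_center_iff_coeff] at ha hb
  rw [MonoidAlgebra.coeff_mul_eq_sum]
  let _ : MulAction R G := MulAction.compHom G ((MulAut.conj (G := G)).comp R.subtype)
  have hsmul : ∀ (r : R) (u : G), r • u = r * u * (r : G)⁻¹ := fun _ _ => rfl
  rw [hR.sum_eq_sum_fixedPoints]
  · have hfix : ∀ u : G, u ∈ MulAction.fixedPoints R G ↔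
        u ∈ Subgroup.centralizer (R : Set G) := by
      intro u
      rw [Subgroup.mem_centralizer_iff]
      constructor
      · intro h r hr
        have := h ⟨r, hr⟩
        rw [hsmul] at this
        exact mul_inv_eq_iff_eq_mul.1 this
      · intro h r
        rw [hsmul]
        exact mul_inv_eq_iff_eq_mul.2 (h r r.2)
    simp only [hfix]
    rw [← Finset.sum_filter]
    exact Finset.sum_subtype _ (by simp) (fun u => a.coeff u * b.coeff (u⁻¹ * y))
  · intro r u
    have hry : (r : G) * y = y * r := Subgroup.mem_centralizer_iff.1 hy r r.2
    rw [hsmul, ha, ← hb r (u⁻¹ * y)]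
    congr 2
    rw [mul_assoc (r : G) (u⁻¹ * y), mul_assoc u⁻¹ y,
      show y * (r : G)⁻¹ = (r : G)⁻¹ * y by
        rw [eq_inv_mul_iff_mul_eq, ← mul_assoc, hry, mul_inv_cancel_right]]
    group

/-- In characteristic `p`, the trace of `u ↦ (a * n) * u * y⁻¹` is zero when `n` is central and
nilpotent; in coefficients this says that the relative trace of `a * n` vanishes. -/
lemma sum_coeff_conj_mul_eq_zero {F : Type} [Field F] {H : Type} [Group H] [Fintype H]
    (a : MonoidAlgebra F H) {n : MonoidAlgebra F H}
    (hn : n ∈ Subalgebra.center F (MonoidAlgebra F H)) (hnil : IsNilpotent n) (y : H) :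
    ∑ h, (a * n).coeff (h * y * h⁻¹) = 0 := by
  let T : MonoidAlgebra F H →ₗ[F] MonoidAlgebra F H :=
    LinearMap.mulLeft F a ∘ₗ LinearMap.mulRight F (MonoidAlgebra.single y⁻¹ (1 : F))
  have hcomm : Commute (LinearMap.mulLeft F n) T := by
    ext1 u
    ext1
    simp only [T, Module.End.mul_apply, LinearMap.comp_apply, LinearMap.mulLeft_apply,
      LinearMap.mulRight_apply, ← mul_assoc, Subalgebra.mem_center_iff.1 hn a]
  have h1 : IsNilpotent (LinearMap.mulLeft F n * T) :=
    hcomm.isNilpotent_mul_right ((LinearMap.isNilpotent_mulLeft_iff F n).2 hnil)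
  have h2 := (LinearMap.isNilpotent_trace_of_isNilpotent h1).eq_zero
  rw [LinearMap.trace_eq_matrix_trace F (MonoidAlgebra.basis H F), Matrix.trace] at h2
  rw [← h2]
  refine Finset.sum_congr rfl fun h _ => ?_
  rw [Matrix.diag_apply, LinearMap.toMatrix_apply]
  have hT : (LinearMap.mulLeft F n * T) (MonoidAlgebra.single h 1) =
      (a * n) * MonoidAlgebra.single (h * y⁻¹) 1 := by
    simp only [T, Module.End.mul_apply, LinearMap.comp_apply, LinearMap.mulLeft_apply,
      LinearMap.mulRight_apply, MonoidAlgebra.single_mul_single, mul_one, ← mul_assoc,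
      Subalgebra.mem_center_iff.1 hn a]
  have hb : (MonoidAlgebra.basis H F) h = MonoidAlgebra.single h 1 := by simp
  rw [hb, hT]
  have hr : ∀ w : MonoidAlgebra F H, (MonoidAlgebra.basis H F).repr w h = w.coeff h := by
    intro w
    rfl
  rw [hr, MonoidAlgebra.coeff_mul_single_apply, mul_one]
  congr 1
  group

/-- A central element supported on classes of `p`-defect zero is annihilated by every central
nilpotent element. -/
lemma mul_eq_zero_of_defect_zero {F : Type} [Field F] {H : Type} [Group H] [Fintype H]
    {p : ℕ} [Fact p.Prime] [CharP F p] {b n : MonoidAlgebra F H}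
    (hb : b ∈ Subalgebra.center F (MonoidAlgebra F H))
    (hsupp : ∀ x, b.coeff x ≠ 0 → ∀ u, Commute u x → u ^ p = 1 → u = 1)
    (hn : n ∈ Subalgebra.center F (MonoidAlgebra F H)) (hnil : IsNilpotent n) :
    b * n = 0 := by
  have hbc := (MonoidAlgebra.mem_center_iff_coeff b).1 hb
  have hnc := (MonoidAlgebra.mem_center_iff_coeff n).1 hn
  let N : H → ℕ := fun x => (Finset.univ.filter fun h : H => h * x * h⁻¹ = x).card
  let rep : H → H := fun x => Quotient.out (ConjClasses.mk x)
  let b' : MonoidAlgebra F H :=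
    MonoidAlgebra.ofFun fun x => if x = rep x then b.coeff x * (N x : F)⁻¹ else 0
  have hN : ∀ x, b.coeff x ≠ 0 → (N x : F) ≠ 0 := by
    intro x hx h0
    rw [CharP.cast_eq_zero_iff F p] at h0
    have hcard : N x = Nat.card (Subgroup.centralizer ({x} : Set H)) := by
      rw [Nat.card_eq_fintype_card]
      refine (Fintype.card_of_subtype _ fun h => ?_).symm
      rw [Finset.mem_filter, Subgroup.mem_centralizer_singleton_iff, mul_inv_eq_iff_eq_mul]
      simp
    rw [hcard] at h0
    obtain ⟨u, hu⟩ := exists_prime_orderOf_dvd_card' p h0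
    have h1 : (u : H) = 1 := by
      refine hsupp x hx u (Subgroup.mem_centralizer_singleton_iff.1 u.2) ?_
      rw [← hu, ← SubmonoidClass.coe_pow, pow_orderOf_eq_one, OneMemClass.coe_one]
    have h2 : u = 1 := Subtype.ext h1
    rw [h2, orderOf_one] at hu
    exact (Fact.out : p.Prime).one_lt.ne hu
  have hsum : ∀ x, b.coeff x = ∑ h, b'.coeff (h * x * h⁻¹) := by
    intro x
    obtain ⟨g, hg⟩ := isConj_iff.1 (ConjClasses.mk_eq_mk_iff_isConj.1
      (Quotient.out_eq (ConjClasses.mk x)).symm : IsConj x (rep x))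
    have h1 : ∀ h, b'.coeff (h * x * h⁻¹) =
        if h * x * h⁻¹ = rep x then b.coeff x * (N (rep x) : F)⁻¹ else 0 := by
      intro h
      have : rep (h * x * h⁻¹) = rep x := by simp only [rep, ConjClasses.mk_conj]
      simp only [b', MonoidAlgebra.coeff_ofFun, this, hbc]
      split_ifs with h2
      · rw [h2]
      · rfl
    simp only [h1]
    rw [← Finset.sum_filter, Finset.sum_const, nsmul_eq_mul]
    have h2 : (Finset.univ.filter fun h : H => h * x * h⁻¹ = rep x).card = N (rep x) := by
      refine Finset.card_equiv (Equiv.mulRight g⁻¹) fun h => ?_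
      simp only [Finset.mem_filter, Finset.mem_univ, true_and, Equiv.coe_mulRight]
      nth_rewrite 2 [← hg]
      rw [show h * g⁻¹ * (g * x * g⁻¹) * (h * g⁻¹)⁻¹ = h * x * h⁻¹ by group]
    rw [h2]
    by_cases hx : b.coeff x = 0
    · simp [hx]
    · have : b.coeff (rep x) ≠ 0 := by rwa [← hg, hbc]
      rw [mul_left_comm, mul_inv_cancel₀ (hN _ this), mul_one]
  ext y
  rw [MonoidAlgebra.coeff_mul_eq_sum]
  simp only [hsum, Finset.sum_mul]
  rw [Finset.sum_comm, MonoidAlgebra.coeff_zero, Finsupp.zero_apply,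
    ← sum_coeff_conj_mul_eq_zero b' hn hnil y]
  refine Finset.sum_congr rfl fun h _ => ?_
  rw [MonoidAlgebra.coeff_mul_eq_sum]
  refine Fintype.sum_equiv (MulAut.conj h).toEquiv _ _ fun u => ?_
  rw [← hnc h (u⁻¹ * y)]
  simp only [MulEquiv.toEquiv_eq_coe, MulEquiv.coe_toEquiv, MulAut.conj_apply]
  congr 2
  group

/-- An exponent `e` such that `x ↦ x ^ e` is the projection to the part of order prime to `p`. -/
lemma exists_pow_isPRegularPart (C : Type) [Group C] [Finite C] (p : ℕ) [Fact p.Prime] :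
    ∃ e : ℕ, p ∣ e ∧ (∀ (x : C) (k : ℕ), x ^ p ^ k = 1 → x ^ e = 1) ∧
      ∀ x : C, ∃ k : ℕ, (x ^ e * x⁻¹) ^ p ^ k = 1 := by
  have hp : p.Prime := Fact.out
  obtain ⟨A, q, hq, hc⟩ := Nat.exists_eq_pow_mul_and_not_dvd (Nat.card_pos (α := C)).ne' p
    hp.ne_one
  have hcop : Nat.Coprime (p ^ (A + 1)) q :=
    Nat.Coprime.pow_left _ ((Nat.Prime.coprime_iff_not_dvd hp).2 hq)
  obtain ⟨e, he0, he1⟩ := Nat.chineseRemainder hcop 0 1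
  have hdvd : p ^ (A + 1) ∣ e := (Nat.modEq_zero_iff_dvd).1 he0
  refine ⟨e, (dvd_pow_self p (Nat.succ_ne_zero A)).trans hdvd, fun x k hx => ?_, fun x => ?_⟩
  · have h1 : orderOf x ∣ p ^ k := orderOf_dvd_of_pow_eq_one hx
    have h2 : orderOf x ∣ p ^ A * q := hc ▸ orderOf_dvd_natCard x
    have h3 : Nat.Coprime (orderOf x) q := Nat.Coprime.coprime_dvd_left h1
      (Nat.Coprime.pow_left _ ((Nat.Prime.coprime_iff_not_dvd hp).2 hq))
    exact orderOf_dvd_iff_pow_eq_one.1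
      (((h3.dvd_of_dvd_mul_right h2).trans (pow_dvd_pow p A.le_succ)).trans hdvd)
  · refine ⟨A, ?_⟩
    have hcm : Commute (x ^ e) x⁻¹ := ((Commute.refl x).pow_left e).inv_right
    rw [hcm.mul_pow, inv_pow, mul_inv_eq_one, ← pow_mul, pow_eq_pow_iff_modEq]
    have h1 : e * p ^ A ≡ p ^ A [MOD q * p ^ A] := by
      simpa using Nat.ModEq.mul_right' (p ^ A) he1
    refine h1.of_dvd ?_
    rw [mul_comm, ← hc]
    exact orderOf_dvd_natCard x

/-- The elements of `C` all of whose commuting `p`-elements lie in the subgroup `Z`. -/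
def minimalDefectSet {C : Type} [Group C] (p : ℕ) (Z : Subgroup C) : Set C :=
  {x | ∀ u, Commute u x → (∃ k : ℕ, u ^ p ^ k = 1) → u ∈ Z}

lemma mul_mem_centralSupp_minimalDefectSet {F : Type} [Field F] {C : Type} [Group C] [Fintype C]
    {p : ℕ} [Fact p.Prime] [CharP F p] {Z : Subgroup C} {b n : MonoidAlgebra F C}
    (hb : b ∈ centralSupp F (minimalDefectSet p Z))
    (hn : n ∈ Subalgebra.center F (MonoidAlgebra F C)) :
    b * n ∈ centralSupp F (minimalDefectSet p Z) := by
  refine ⟨mul_mem hb.1 hn, fun x hx u hux ⟨k, hk⟩ => ?_⟩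
  have hR : IsPGroup p (Subgroup.zpowers u) := by
    refine IsPGroup.of_card_dvd_pow (n := k) ?_
    rw [Nat.card_zpowers]
    exact orderOf_dvd_of_pow_eq_one hk
  have hxC : x ∈ Subgroup.centralizer (Subgroup.zpowers u : Set C) := by
    rw [Subgroup.mem_centralizer_iff]
    rintro _ ⟨i, rfl⟩
    exact (hux.zpow_left i)
  rw [coeff_mul_eq_sum_centralizer hR hb.1 hn hxC] at hx
  obtain ⟨v, -, hv⟩ := Finset.exists_ne_zero_of_sum_ne_zero hx
  exact hb.2 v (left_ne_zero_of_mul hv) u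
    (Subgroup.mem_centralizer_iff.1 v.2 u (Subgroup.mem_zpowers u)) ⟨k, hk⟩

lemma coeff_mapDomain_mk {F : Type} [Field F] {C : Type} [Group C] [Fintype C]
    {Z : Subgroup C} [Z.Normal] (a : MonoidAlgebra F C) (x : C) :
    (MonoidAlgebra.mapDomainAlgHom F F (QuotientGroup.mk' Z) a).coeff (QuotientGroup.mk' Z x) =
      ∑ z : Z, a.coeff (z * x) := by
  conv_lhs => rw [MonoidAlgebra.eq_sum_single a]
  rw [map_sum]
  simp only [MonoidAlgebra.coeff_sum, Finsupp.finsetSum_apply]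
  have h1 : ∀ g : C, ((MonoidAlgebra.mapDomainAlgHom F F (QuotientGroup.mk' Z))
      (MonoidAlgebra.single g (a.coeff g))).coeff (QuotientGroup.mk' Z x) =
      if g * x⁻¹ ∈ Z then a.coeff g else 0 := by
    intro g
    have h2 : (MonoidAlgebra.mapDomainAlgHom F F (QuotientGroup.mk' Z))
        (MonoidAlgebra.single g (a.coeff g)) =
        MonoidAlgebra.single (QuotientGroup.mk' Z g) (a.coeff g) :=
      MonoidAlgebra.mapDomain_single
    rw [h2, MonoidAlgebra.coeff_single, Finsupp.single_apply]
    refine if_congr ?_ rfl rfl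
    rw [← mul_inv_eq_one, ← map_inv, ← map_mul, ← MonoidHom.mem_ker, QuotientGroup.ker_mk']
  simp only [h1]
  rw [← Finset.sum_filter, Finset.sum_subtype (p := fun g => g * x⁻¹ ∈ Z) _ (by simp)]
  exact Fintype.sum_equiv ((Equiv.mulRight x⁻¹).subtypeEquiv (q := (· ∈ Z)) (by simp)) _ _
    fun g => congrArg a.coeff (inv_mul_cancel_right (g : C) x).symm

lemma mapDomain_mk_mem_center {F : Type} [Field F] {C : Type} [Group C] [Fintype C]
    {Z : Subgroup C} [Z.Normal] (hZ : Z ≤ Subgroup.center C) {a : MonoidAlgebra F C}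
    (ha : a ∈ Subalgebra.center F (MonoidAlgebra F C)) :
    MonoidAlgebra.mapDomainAlgHom F F (QuotientGroup.mk' Z) a ∈
      Subalgebra.center F (MonoidAlgebra F (C ⧸ Z)) := by
  rw [MonoidAlgebra.mem_center_iff_coeff] at ha ⊢
  intro g x
  obtain ⟨g, rfl⟩ := QuotientGroup.mk'_surjective Z g
  obtain ⟨x, rfl⟩ := QuotientGroup.mk'_surjective Z x
  rw [← map_inv, ← map_mul, ← map_mul, coeff_mapDomain_mk, coeff_mapDomain_mk]
  refine Finset.sum_congr rfl fun z _ => ?_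
  rw [← ha g (z * x)]
  congr 1
  simp only [← mul_assoc]
  rw [Subgroup.mem_center_iff.1 (hZ z.2) g]

/-- The products `b * n`, with `b` of minimal defect `Z` and `n` a central nilpotent element,
vanish in the group algebra of `C ⧸ Z`. -/
lemma sum_coeff_mul_eq_zero {F : Type} [Field F] {C : Type} [Group C] [Fintype C]
    {p : ℕ} [Fact p.Prime] [CharP F p] {Z : Subgroup C} (hZ : Z ≤ Subgroup.center C)
    (hZp : IsPGroup p Z) {b n : MonoidAlgebra F C}
    (hb : b ∈ centralSupp F (minimalDefectSet p Z))
    (hn : n ∈ Subalgebra.center F (MonoidAlgebra F C)) (hnil : IsNilpotent n) (x : C) :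
    ∑ z : Z, (b * n).coeff (z * x) = 0 := by
  have hnormal : Z.Normal :=
    ⟨fun z hz g => by rwa [Subgroup.mem_center_iff.1 (hZ hz) g, mul_inv_cancel_right]⟩
  rw [← coeff_mapDomain_mk, map_mul, mul_eq_zero_of_defect_zero (p := p)
    (mapDomain_mk_mem_center hZ hb.1) ?_ (mapDomain_mk_mem_center hZ hn) (hnil.map _)]
  · simp
  intro y hy u huy hup
  obtain ⟨y, rfl⟩ := QuotientGroup.mk'_surjective Z y
  obtain ⟨g, rfl⟩ := QuotientGroup.mk'_surjective Z u
  rw [coeff_mapDomain_mk] at hy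
  obtain ⟨z, -, hz⟩ := Finset.exists_ne_zero_of_sum_ne_zero hy
  obtain ⟨e, hpe, he1, he2⟩ := exists_pow_isPRegularPart C p
  set w : C := z * y with hw
  have hwy : QuotientGroup.mk' Z w = QuotientGroup.mk' Z y := by
    rw [hw, map_mul, (QuotientGroup.eq_one_iff (z : C)).2 z.2 |> fun h =>
      (show QuotientGroup.mk' Z (z : C) = 1 from h), one_mul]
  rw [← hwy] at huy
  have hS := hb.2 w hz
  have hconj : g * w * g⁻¹ * w⁻¹ ∈ Z := by
    rw [← QuotientGroup.ker_mk' Z, MonoidHom.mem_ker]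
    simp only [map_mul, map_inv]
    rw [huy.eq]
    group
  have hconjp : (g * w * g⁻¹) ^ e = w ^ e := by
    obtain ⟨k, hk⟩ := hZp ⟨_, hconj⟩
    have h1 : (g * w * g⁻¹ * w⁻¹) ^ e = 1 := he1 _ k (congrArg Subtype.val hk)
    have h2 : Commute (g * w * g⁻¹ * w⁻¹) w := (Subgroup.mem_center_iff.1 (hZ hconj) w).symm
    calc (g * w * g⁻¹) ^ e = (g * w * g⁻¹ * w⁻¹ * w) ^ e := by rw [inv_mul_cancel_right]
      _ = w ^ e := by rw [h2.mul_pow, h1, one_mul]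
  have hge : Commute g (w ^ e) := by
    rw [conj_pow, mul_inv_eq_iff_eq_mul] at hconjp
    exact hconjp
  have hc : w ^ e * w⁻¹ ∈ Z :=
    hS _ (((Commute.refl w).pow_left e).mul_left (Commute.refl w).inv_left) (he2 w)
  have hgw : Commute g w := by
    have h1 : w = (w ^ e * w⁻¹)⁻¹ * w ^ e := by group
    rw [h1]
    exact (Commute.inv_right (Subgroup.mem_center_iff.1 (hZ hc) g)).mul_right hge
  have hg : g ^ e * g⁻¹ ∈ Z := hS _ ((hgw.pow_left e).mul_left hgw.inv_left) (he2 g)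
  rw [← QuotientGroup.ker_mk' Z, MonoidHom.mem_ker, map_mul, map_pow, map_inv] at hg
  obtain ⟨f, rfl⟩ := hpe
  rw [pow_mul, hup, one_pow, one_mul, inv_eq_one] at hg
  exact hg

/-- The span of the differences `z - 1` with `z ∈ Z`. -/
noncomputable def augmentationSpan (F : Type) [Field F] {C : Type} [Group C] (Z : Subgroup C) :
    Submodule F (MonoidAlgebra F C) :=
  Submodule.span F (Set.range fun z : Z => MonoidAlgebra.single (z : C) (1 : F) - 1)

/-- The span of the central nilpotent elements. -/
noncomputable def centralNilSpan (F : Type) [Field F] (C : Type) [Group C] :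
    Submodule F (MonoidAlgebra F C) :=
  Submodule.span F {n | n ∈ Subalgebra.center F (MonoidAlgebra F C) ∧ IsNilpotent n}

lemma mul_mem_augmentationSpan_mul {F : Type} [Field F] {C : Type} [Group C] [Fintype C]
    {p : ℕ} [Fact p.Prime] {Z : Subgroup C} (hZ : Z ≤ Subgroup.center C)
    (hZp : IsPGroup p Z) {w : MonoidAlgebra F C}
    (hw : w ∈ centralSupp F (minimalDefectSet p Z))
    (hsum : ∀ x, ∑ z : Z, w.coeff (z * x) = 0) :
    w ∈ augmentationSpan F Z * centralSupp F (minimalDefectSet p Z) := by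
  obtain ⟨e, -, he1, he2⟩ := exists_pow_isPRegularPart C p
  have hwc := (MonoidAlgebra.mem_center_iff_coeff w).1 hw.1
  have hzc : ∀ (z : Z) (x : C), x * z = z * x := fun z x => Subgroup.mem_center_iff.1 (hZ z.2) x
  have hze : ∀ (z : Z) (x : C), (z * x : C) ^ e = x ^ e := by
    intro z x
    obtain ⟨k, hk⟩ := hZp z
    have h1 : (z : C) ^ e = 1 := he1 _ k (congrArg Subtype.val hk)
    have h2 : Commute (z : C) x := (hzc z x).symm
    rw [h2.mul_pow, h1, one_mul]
  let b : Z → MonoidAlgebra F C := fun z =>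
    MonoidAlgebra.ofFun fun x => if x ^ e = x then w.coeff (z * x) else 0
  have hb : ∀ z, b z ∈ centralSupp F (minimalDefectSet p Z) := by
    intro z
    refine ⟨(MonoidAlgebra.mem_center_iff_coeff _).2 fun g x => ?_, fun x hx u hu hk => ?_⟩
    · simp only [b, MonoidAlgebra.coeff_ofFun, conj_pow]
      have h1 : (z : C) * (g * x * g⁻¹) = g * (z * x) * g⁻¹ := by
        simp only [← mul_assoc, hzc z g]
      rw [h1, hwc]
      simp only [mul_left_inj, mul_right_inj]
    · simp only [b, MonoidAlgebra.coeff_ofFun, ne_eq, ite_eq_right_iff, Classical.not_imp] at hx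
      exact hw.2 _ hx.2 u (Commute.mul_right (hzc z u) hu) hk
  have hsub : w = ∑ z : Z, (MonoidAlgebra.single (z : C) (1 : F) - 1) * b z := by
    have h0 : ∑ z : Z, b z = 0 := by
      ext x
      simp only [MonoidAlgebra.coeff_sum, Finsupp.finsetSum_apply, b, MonoidAlgebra.coeff_ofFun,
        MonoidAlgebra.coeff_zero, Finsupp.zero_apply]
      split_ifs
      · exact hsum x
      · simp
    simp only [sub_mul, one_mul, Finset.sum_sub_distrib, h0, sub_zero]
    ext x
    simp only [MonoidAlgebra.coeff_sum, Finsupp.finsetSum_apply,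
      MonoidAlgebra.coeff_single_mul_apply, one_mul, b, MonoidAlgebra.coeff_ofFun,
      mul_inv_cancel_left]
    have h1 : ∀ z : Z, ((z : C)⁻¹ * x) ^ e = x ^ e := fun z => by
      simpa using hze z⁻¹ x
    simp only [h1]
    by_cases hx : w.coeff x = 0
    · simp [hx]
    · have hmem : x ^ e * x⁻¹ ∈ Z := hw.2 x hx _
        (((Commute.refl x).pow_left e).mul_left (Commute.refl x).inv_left) (he2 x)
      rw [Finset.sum_eq_single (⟨x ^ e * x⁻¹, hmem⟩⁻¹ : Z)]
      · simp
      · intro z _ hz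
        rw [if_neg]
        intro h2
        apply hz
        apply Subtype.ext
        simp [h2]
      · simp
  rw [hsub]
  exact Submodule.sum_mem _ fun z _ =>
    Submodule.mul_mem_mul (Submodule.subset_span ⟨z, rfl⟩) (hb z)

/-- Multiplication by a central nilpotent element pushes elements of minimal defect `Z` one step
down the powers of the augmentation ideal of `Z`. -/
lemma centralSupp_mul_centralNilSpan_pow_le {F : Type} [Field F] {C : Type} [Group C] [Fintype C]
    {p : ℕ} [Fact p.Prime] [CharP F p] {Z : Subgroup C} (hZ : Z ≤ Subgroup.center C)
    (hZp : IsPGroup p Z) (i : ℕ) :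
    centralSupp F (minimalDefectSet p Z) * centralNilSpan F C ^ i ≤
      augmentationSpan F Z ^ i * centralSupp F (minimalDefectSet p Z) := by
  have h1 : centralSupp F (minimalDefectSet p Z) * centralNilSpan F C ≤
      augmentationSpan F Z * centralSupp F (minimalDefectSet p Z) := by
    refine Submodule.mul_le.2 fun b hb n hn => ?_
    induction hn using Submodule.span_induction with
    | mem n hn =>
      exact mul_mem_augmentationSpan_mul hZ hZp (mul_mem_centralSupp_minimalDefectSet hb hn.1)
        (sum_coeff_mul_eq_zero hZ hZp hb hn.1 hn.2)
    | zero => rw [mul_zero]; exact zero_mem _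
    | add x y _ _ hx hy => rw [mul_add]; exact add_mem hx hy
    | smul c x _ hx => rw [mul_smul_comm]; exact Submodule.smul_mem _ _ hx
  induction i with
  | zero => simp
  | succ i ih =>
    calc _ = centralSupp F (minimalDefectSet p Z) * centralNilSpan F C ^ i *
          centralNilSpan F C := by rw [Submodule.pow_succ, mul_assoc]
      _ ≤ augmentationSpan F Z ^ i * centralSupp F (minimalDefectSet p Z) *
          centralNilSpan F C := mul_le_mul_left ih _
      _ ≤ _ := by
        rw [Submodule.pow_succ, mul_assoc, mul_assoc]
        exact mul_le_mul_right h1 _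

/-- A `p`-subgroup of `C_G(x)` is conjugate into every defect group of the class of `x`. -/
lemma IsClassDefectGroup.exists_map_conj_le {G : Type} [Group G] [Finite G] {p : ℕ}
    [Fact p.Prime] {R : Subgroup G} {x : G} (hR : IsClassDefectGroup p R (ConjClasses.mk x))
    {P : Subgroup G} (hP : IsPGroup p P) (hPx : ∀ u ∈ P, Commute u x) :
    ∃ g : G, P.map (MulAut.conj g).toMonoidHom ≤ R := by
  obtain ⟨x', hx', S, rfl⟩ := hR
  rw [ConjClasses.mem_carrier_iff_mk_eq, ConjClasses.mk_eq_mk_iff_isConj] at hx'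
  obtain ⟨g, hg⟩ := isConj_iff.1 hx'.symm
  have hmem : ∀ u ∈ P, g * u * g⁻¹ ∈ Subgroup.centralizer ({x'} : Set G) := by
    intro u hu
    rw [Subgroup.mem_centralizer_singleton_iff, ← hg]
    calc g * u * g⁻¹ * (g * x * g⁻¹) = g * (u * x) * g⁻¹ := by group
      _ = g * x * g⁻¹ * (g * u * g⁻¹) := by rw [(hPx u hu).eq]; group
  obtain ⟨T, hT⟩ := IsPGroup.exists_le_sylow
    ((hP.map (MulAut.conj g).toMonoidHom).comap_subtype
      (K := Subgroup.centralizer ({x'} : Set G)))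
  obtain ⟨c, hc⟩ := MulAction.exists_smul_eq (Subgroup.centralizer ({x'} : Set G)) T S
  refine ⟨c * g, ?_⟩
  rintro _ ⟨u, hu, rfl⟩
  have h1 : (⟨g * u * g⁻¹, hmem u hu⟩ : Subgroup.centralizer ({x'} : Set G)) ∈ T :=
    hT ⟨u, hu, rfl⟩
  have h2 : c * ⟨g * u * g⁻¹, hmem u hu⟩ * c⁻¹ ∈ S := by
    rw [← hc]
    exact Subgroup.smul_mem_pointwise_smul _ (MulAut.conj c) _ h1
  refine ⟨_, h2, ?_⟩
  simp [mul_assoc]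

/-- Conjugates of Sylow `p`-subgroups of `C_G(y)` are defect groups of the class of `y`. -/
lemma Sylow.isClassDefectGroup_map_conj {G : Type} [Group G] {p : ℕ} {y : G}
    (T : Sylow p (Subgroup.centralizer ({y} : Set G))) (g : G) :
    IsClassDefectGroup p ((T.toSubgroup.map (Subgroup.centralizer {y}).subtype).map
      (MulAut.conj g).toMonoidHom) (ConjClasses.mk y) := by
  have hmem : ∀ u, u ∈ Subgroup.centralizer ({y} : Set G) ↔
      g * u * g⁻¹ ∈ Subgroup.centralizer ({g * y * g⁻¹} : Set G) := by
    intro u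
    rw [Subgroup.mem_centralizer_singleton_iff, Subgroup.mem_centralizer_singleton_iff,
      show g * u * g⁻¹ * (g * y * g⁻¹) = g * (u * y) * g⁻¹ by group,
      show g * y * g⁻¹ * (g * u * g⁻¹) = g * (y * u) * g⁻¹ by group, mul_left_inj,
      mul_right_inj]
  let φ : Subgroup.centralizer ({y} : Set G) ≃* Subgroup.centralizer ({g * y * g⁻¹} : Set G) :=
    { (MulAut.conj g).toEquiv.subtypeEquiv hmem with
      map_mul' := fun a b => Subtype.ext (map_mul (MulAut.conj g) (a : G) b) }
  refine ⟨g * y * g⁻¹, ?_, T.comapOfInjective φ.symm.toMonoidHom φ.symm.injective (by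
    rw [MonoidHom.range_eq_top.2 φ.symm.surjective]; exact le_top), ?_⟩
  · rw [ConjClasses.mem_carrier_iff_mk_eq, ConjClasses.mk_conj]
  · ext u
    simp only [Subgroup.mem_map]
    constructor
    · rintro ⟨_, ⟨t, ht, rfl⟩, rfl⟩
      refine ⟨φ t, ?_, rfl⟩
      change φ.symm (φ t) ∈ T
      rwa [φ.symm_apply_apply]
    · rintro ⟨t, ht, rfl⟩
      refine ⟨_, ⟨φ.symm t, ht, rfl⟩, ?_⟩
      exact congrArg Subtype.val (φ.apply_symm_apply t)

lemma classIdealLE_eq_centralSupp {F : Type} [Field F] {G : Type} [Group G] [Fintype G] (p : ℕ)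
    (Q : Subgroup G) : classIdealLE F p Q =
      centralSupp F {x | ∃ R, R ≤ Q ∧ IsClassDefectGroup p R (ConjClasses.mk x)} :=
  iSup_classIdeal_eq_centralSupp p (· ≤ Q)

lemma classIdealLT_eq_centralSupp {F : Type} [Field F] {G : Type} [Group G] [Fintype G] (p : ℕ)
    (Q : Subgroup G) : classIdealLT F p Q =
      centralSupp F {x | ∃ R, R < Q ∧ IsClassDefectGroup p R (ConjClasses.mk x)} :=
  iSup_classIdeal_eq_centralSupp p (· < Q)

lemma mul_mem_classIdealLE {F : Type} [Field F] {G : Type} [Group G] [Fintype G] {p : ℕ}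
    [Fact p.Prime] [CharP F p] {Q : Subgroup G} {w n : MonoidAlgebra F G}
    (hw : w ∈ classIdealLE F p Q) (hn : n ∈ Subalgebra.center F (MonoidAlgebra F G)) :
    w * n ∈ classIdealLE F p Q := by
  rw [classIdealLE_eq_centralSupp] at hw ⊢
  refine ⟨mul_mem hw.1 hn, fun y hy => ?_⟩
  obtain ⟨T⟩ : Nonempty (Sylow p (Subgroup.centralizer ({y} : Set G))) := inferInstance
  set R := T.toSubgroup.map (Subgroup.centralizer {y}).subtype with hR
  have hRp : IsPGroup p R := T.isPGroup'.map _
  have hyR : y ∈ Subgroup.centralizer (R : Set G) := by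
    rw [Subgroup.mem_centralizer_iff]
    rintro _ ⟨t, -, rfl⟩
    exact Subgroup.mem_centralizer_singleton_iff.1 t.2
  rw [coeff_mul_eq_sum_centralizer hRp hw.1 hn hyR] at hy
  obtain ⟨v, -, hv⟩ := Finset.exists_ne_zero_of_sum_ne_zero hy
  obtain ⟨R', hR'Q, hR'⟩ := hw.2 v (left_ne_zero_of_mul hv)
  obtain ⟨g, hg⟩ := hR'.exists_map_conj_le hRp
    fun u hu => Subgroup.mem_centralizer_iff.1 v.2 u hu
  exact ⟨_, hg.trans hR'Q, T.isClassDefectGroup_map_conj g⟩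

/-- The Brauer map: restriction of coefficients to `C_G(R)`. -/
noncomputable def brauerMap (F : Type) [Field F] {G : Type} [Group G] [Fintype G]
    (R : Subgroup G) :
    MonoidAlgebra F G →ₗ[F] MonoidAlgebra F (Subgroup.centralizer (R : Set G)) where
  toFun a := MonoidAlgebra.ofFun fun u => a.coeff u
  map_add' a b := by ext; simp
  map_smul' c a := by ext; simp

@[simp]
lemma coeff_brauerMap {F : Type} [Field F] {G : Type} [Group G] [Fintype G] (R : Subgroup G)
    (a : MonoidAlgebra F G) (u : Subgroup.centralizer (R : Set G)) :
    (brauerMap F R a).coeff u = a.coeff u := rfl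

lemma brauerMap_mul {F : Type} [Field F] {G : Type} [Group G] [Fintype G] {p : ℕ} [Fact p.Prime]
    [CharP F p] {R : Subgroup G} (hR : IsPGroup p R) {a b : MonoidAlgebra F G}
    (ha : a ∈ Subalgebra.center F (MonoidAlgebra F G))
    (hb : b ∈ Subalgebra.center F (MonoidAlgebra F G)) :
    brauerMap F R (a * b) = brauerMap F R a * brauerMap F R b := by
  ext y
  rw [coeff_brauerMap, coeff_mul_eq_sum_centralizer hR ha hb y.2, MonoidAlgebra.coeff_mul_eq_sum]
  rfl

lemma brauerMap_mem_center {F : Type} [Field F] {G : Type} [Group G] [Fintype G] (R : Subgroup G)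
    {a : MonoidAlgebra F G} (ha : a ∈ Subalgebra.center F (MonoidAlgebra F G)) :
    brauerMap F R a ∈ Subalgebra.center F (MonoidAlgebra F (Subgroup.centralizer (R : Set G))) := by
  rw [MonoidAlgebra.mem_center_iff_coeff] at ha ⊢
  exact fun g x => ha g x

lemma isNilpotent_brauerMap {F : Type} [Field F] {G : Type} [Group G] [Fintype G] {p : ℕ}
    [Fact p.Prime] [CharP F p] {R : Subgroup G} (hR : IsPGroup p R) {a : MonoidAlgebra F G}
    (ha : a ∈ Subalgebra.center F (MonoidAlgebra F G)) (hnil : IsNilpotent a) :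
    IsNilpotent (brauerMap F R a) := by
  obtain ⟨k, hk⟩ := hnil
  have hpow : ∀ k, brauerMap F R (a ^ (k + 1)) = brauerMap F R a ^ (k + 1) := by
    intro k
    induction k with
    | zero => simp
    | succ k ih => rw [pow_succ, brauerMap_mul hR (pow_mem ha _) ha, ih, ← pow_succ]
  exact ⟨k + 1, by rw [← hpow, pow_succ, hk, zero_mul, map_zero]⟩

lemma mem_center_and_isNilpotent_of_mem_JZ {F : Type} [Field F] {G : Type} [Group G] [Fintype G]
    {n : MonoidAlgebra F G} (hn : n ∈ JZ F G) :
    n ∈ Subalgebra.center F (MonoidAlgebra F G) ∧ IsNilpotent n := by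
  obtain ⟨c, hc, rfl⟩ := hn
  refine ⟨c.2, ?_⟩
  have : Module.Finite F (MonoidAlgebra F G) := Module.Finite.of_basis (MonoidAlgebra.basis G F)
  have : IsArtinianRing (Subalgebra.center F (MonoidAlgebra F G)) := IsArtinianRing.of_finite F _
  obtain ⟨k, hk⟩ := IsArtinianRing.isNilpotent_jacobson_bot
    (R := Subalgebra.center F (MonoidAlgebra F G))
  have h1 : c ^ k ∈ (Ideal.jacobson (⊥ : Ideal (Subalgebra.center F (MonoidAlgebra F G)))) ^ k :=
    Ideal.pow_mem_pow hc k
  have h2 : c ^ k = 0 := by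
    rw [hk] at h1
    exact h1
  exact IsNilpotent.map ⟨k, h2⟩ (Subalgebra.center F (MonoidAlgebra F G)).val

/-- The subgroup `Z(Q)`, mapped into `C_G(Q)`. -/
def centerToCentralizer {G : Type} [Group G] (Q : Subgroup G) :
    Subgroup.center Q →* Subgroup.centralizer (Q : Set G) where
  toFun z := ⟨z, Subgroup.mem_centralizer_iff.2 fun q hq =>
    congrArg Subtype.val (Subgroup.mem_center_iff.1 z.2 ⟨q, hq⟩)⟩
  map_one' := rfl
  map_mul' _ _ := rfl

lemma range_centerToCentralizer_le_center {G : Type} [Group G] (Q : Subgroup G) :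
    (centerToCentralizer Q).range ≤ Subgroup.center (Subgroup.centralizer (Q : Set G)) := by
  rintro _ ⟨z, rfl⟩
  rw [Subgroup.mem_center_iff]
  exact fun g => Subtype.ext (Subgroup.mem_centralizer_iff.1 g.2 z z.1.2).symm

lemma brauerMap_mem_centralSupp {F : Type} [Field F] {G : Type} [Group G] [Fintype G] {p : ℕ}
    [Fact p.Prime] {Q : Subgroup G} (hQ : IsPGroup p Q) {w : MonoidAlgebra F G}
    (hw : w ∈ classIdealLE F p Q) :
    brauerMap F Q w ∈ centralSupp F (minimalDefectSet p (centerToCentralizer Q).range) := by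
  rw [classIdealLE_eq_centralSupp] at hw
  refine ⟨brauerMap_mem_center Q hw.1, fun x hx u hux ⟨k, hk⟩ => ?_⟩
  obtain ⟨R, hRQ, hR⟩ := hw.2 x hx
  have huQ : ∀ q ∈ Q, q * u = u * q := Subgroup.mem_centralizer_iff.1 u.2
  have hxQ : ∀ q ∈ Q, q * x = x * q := Subgroup.mem_centralizer_iff.1 x.2
  have hu : IsPGroup p (Subgroup.zpowers (u : G)) := by
    refine IsPGroup.of_card_dvd_pow (n := k) ?_
    rw [Nat.card_zpowers]
    exact orderOf_dvd_of_pow_eq_one (congrArg Subtype.val hk)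
  have hnorm : Subgroup.zpowers (u : G) ≤ Subgroup.normalizer (Q : Set G) := by
    refine le_trans ?_ (Subgroup.centralizer_le_normalizer (Q : Set G))
    rw [Subgroup.zpowers_le]
    exact u.2
  have hP : IsPGroup p (Q ⊔ Subgroup.zpowers (u : G) : Subgroup G) :=
    hQ.to_sup_of_normal_left' hu hnorm
  have hPx : Q ⊔ Subgroup.zpowers (u : G) ≤ Subgroup.centralizer ({(x : G)} : Set G) := by
    refine sup_le (fun q hq => Subgroup.mem_centralizer_singleton_iff.2 (hxQ q hq)) ?_
    rw [Subgroup.zpowers_le, Subgroup.mem_centralizer_singleton_iff]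
    exact congrArg Subtype.val hux
  obtain ⟨g, hg⟩ := hR.exists_map_conj_le hP
    fun v hv => Subgroup.mem_centralizer_singleton_iff.1 (hPx hv)
  have hcard : Nat.card (Q ⊔ Subgroup.zpowers (u : G) : Subgroup G) ≤ Nat.card Q := by
    rw [← Subgroup.card_map_of_injective (f := (MulAut.conj g).toMonoidHom)
      (MulAut.conj g).injective]
    exact Subgroup.card_le_of_le (hg.trans hRQ)
  have hmem : (u : G) ∈ Q := by
    have h1 : Q ⊔ Subgroup.zpowers (u : G) ≤ Q :=
      (Subgroup.eq_of_le_of_card_ge le_sup_left hcard).ge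
    exact h1 (Subgroup.mem_sup_right (Subgroup.mem_zpowers _))
  refine ⟨⟨⟨u, hmem⟩, Subgroup.mem_center_iff.2 fun q => Subtype.ext (huQ q q.2)⟩, rfl⟩

/-- Nilpotency of the Jacobson radical of `FA`, for an abelian `p`-group `A`, bounds the
nilpotency of the augmentation span of its images. -/
lemma augmentationSpan_range_pow_eq_bot {F : Type} [Field F] {A C : Type} [hG : Group A] [Group C]
    (hcomm : ∀ a b : A, a * b = b * a) {p : ℕ} [Fact p.Prime] [CharP F p] (hA : IsPGroup p A)
    (ι : A →* C) {m : ℕ}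
    (hm : Ideal.jacobson (⊥ : Ideal (MonoidAlgebra F A)) ^ m = ⊥) :
    augmentationSpan F ι.range ^ m = ⊥ := by
  let : CommGroup A := { hG with mul_comm := hcomm }
  have : CharP (MonoidAlgebra F A) p :=
    charP_of_injective_algebraMap (algebraMap F (MonoidAlgebra F A)).injective p
  have hm0 : m ≠ 0 := by
    rintro rfl
    rw [pow_zero, Ideal.one_eq_top] at hm
    exact top_ne_bot hm
  set J := Ideal.jacobson (⊥ : Ideal (MonoidAlgebra F A))
  have hle : augmentationSpan F ι.range ≤
      Submodule.map (MonoidAlgebra.mapDomainAlgHom F F ι).toLinearMap (J.restrictScalars F) := by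
    refine Submodule.span_le.2 ?_
    rintro _ ⟨⟨_, a, rfl⟩, rfl⟩
    refine ⟨MonoidAlgebra.single a 1 - 1, ?_, ?_⟩
    · obtain ⟨k, hk⟩ := hA a
      have hnil : IsNilpotent (MonoidAlgebra.single a (1 : F) - 1) := by
        refine ⟨p ^ k, ?_⟩
        rw [sub_pow_char_pow, MonoidAlgebra.single_pow, hk, one_pow, one_pow,
          ← MonoidAlgebra.one_def, sub_self]
      exact Ideal.radical_le_jacobson (mem_nilradical.2 hnil)
    · have h1 : MonoidAlgebra.mapDomainAlgHom F F ι (MonoidAlgebra.single a 1) =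
        MonoidAlgebra.single (ι a) 1 := MonoidAlgebra.mapDomain_single
      rw [AlgHom.toLinearMap_apply, map_sub, map_one, h1]
  rw [eq_bot_iff]
  refine (pow_le_pow_left' hle m).trans ?_
  rw [← Submodule.map_pow, ← Submodule.restrictScalars_pow hm0, hm]
  simp

/-- `I_{≤Q}(G) * J(Z(FG)) ^ m ≤ I_{<Q}(G)` when `J(F Z(Q)) ^ m = 0`. -/
lemma classIdealLE_mul_JZ_pow_le {F : Type} [Field F] {G : Type} [Group G] [Fintype G] {p : ℕ}
    [Fact p.Prime] [CharP F p] {Q : Subgroup G} (hQ : IsPGroup p Q) {m : ℕ}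
    (hm : augmentationSpan F (centerToCentralizer Q).range ^ m = ⊥) :
    classIdealLE F p Q * JZ F G ^ m ≤ classIdealLT F p Q := by
  have hZp : IsPGroup p (centerToCentralizer Q).range :=
    (hQ.to_subgroup (Subgroup.center Q)).of_surjective _ (MonoidHom.rangeRestrict_surjective _)
  have key : ∀ i, classIdealLE F p Q * JZ F G ^ i ≤ classIdealLE F p Q ⊓
      Submodule.comap (brauerMap F Q)
        (centralSupp F (minimalDefectSet p (centerToCentralizer Q).range) *
          centralNilSpan F (Subgroup.centralizer (Q : Set G)) ^ i) := by
    intro i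
    induction i with
    | zero =>
      rw [pow_zero, pow_zero, mul_one, mul_one]
      exact fun w hw => ⟨hw, brauerMap_mem_centralSupp hQ hw⟩
    | succ i ih =>
      rw [Submodule.pow_succ, Submodule.pow_succ, ← mul_assoc, ← mul_assoc]
      refine Submodule.mul_le.2 fun w hw n hn => ?_
      obtain ⟨hw1, hw2⟩ := ih hw
      obtain ⟨hn1, hn2⟩ := mem_center_and_isNilpotent_of_mem_JZ hn
      refine ⟨mul_mem_classIdealLE hw1 hn1, ?_⟩
      have hwc : w ∈ Subalgebra.center F (MonoidAlgebra F G) := by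
        rw [classIdealLE_eq_centralSupp] at hw1
        exact hw1.1
      rw [SetLike.mem_coe, Submodule.mem_comap, brauerMap_mul hQ hwc hn1]
      exact Submodule.mul_mem_mul hw2
        (Submodule.subset_span ⟨brauerMap_mem_center Q hn1, isNilpotent_brauerMap hQ hn1 hn2⟩)
  intro w hw
  obtain ⟨hw1, hw2⟩ := key m hw
  have hw0 : brauerMap F Q w = 0 := by
    have h1 := centralSupp_mul_centralNilSpan_pow_le
      (range_centerToCentralizer_le_center Q) hZp m hw2
    rwa [hm, Submodule.bot_mul, Submodule.mem_bot] at h1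
  rw [classIdealLE_eq_centralSupp] at hw1
  rw [classIdealLT_eq_centralSupp]
  refine ⟨hw1.1, fun y hy => ?_⟩
  obtain ⟨R, hRQ, hR⟩ := hw1.2 y hy
  refine ⟨R, lt_of_le_of_ne hRQ ?_, hR⟩
  rintro rfl
  obtain ⟨y', hy', S, hS⟩ := hR
  rw [ConjClasses.mem_carrier_iff_mk_eq, ConjClasses.mk_eq_mk_iff_isConj] at hy'
  obtain ⟨g, hg⟩ := isConj_iff.1 hy'.symm
  have hy'R : y' ∈ Subgroup.centralizer (R : Set G) := by
    rw [hS, Subgroup.mem_centralizer_iff]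
    rintro _ ⟨t, -, rfl⟩
    exact Subgroup.mem_centralizer_singleton_iff.1 t.2
  apply hy
  rw [← (MonoidAlgebra.mem_center_iff_coeff w).1 hw1.1 g y, hg]
  exact congrArg (fun b => b.coeff ⟨y', hy'R⟩) hw0

lemma classIdealLT_le_iSup_classIdealLE {F : Type} [Field F] {G : Type} [Group G] [Fintype G]
    (p : ℕ) (Q : Subgroup G) :
    classIdealLT F p Q ≤ ⨆ R, ⨆ _ : R < Q, classIdealLE F p R :=
  iSup₂_mono fun R _ => le_iSup₂_of_le (f := fun Q (_ : Q ≤ R) => classIdeal F p Q) R le_rfl le_rfl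

/-- If `D` is a `p`-subgroup of `G` with `|D| = p^d` and `m : {0,…,d} → ℕ` is such that
`J(F·Z(Q))^(m k) = 0` for every subgroup `Q ≤ D` of order `p^k`, then
`I_{≤D}(G) · J(Z(FG))^(m 0 + m 1 + … + m d) = 0`. -/
theorem stmt5 (F : Type) [Field F] [IsAlgClosed F] (G : Type) [Group G] [Fintype G]
    (p : ℕ) [Fact p.Prime] [CharP F p]
    (D : Subgroup G) (hD : IsPGroup p D) (d : ℕ) (hcard : Fintype.card ↥D = p ^ d)
    (m : ℕ → ℕ)
    (hm : ∀ k ≤ d, ∀ Q : Subgroup G, Q ≤ D → Fintype.card ↥Q = p ^ k →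
      (Ideal.jacobson (⊥ : Ideal (MonoidAlgebra F ↥(Subgroup.center ↥Q)))) ^ (m k) = ⊥) :
    classIdealLE F p D * (JZ F G) ^ (∑ k ∈ Finset.range (d + 1), m k) = ⊥ := by
  have main : ∀ k ≤ d, ∀ Q : Subgroup G, Q ≤ D → Fintype.card Q = p ^ k →
      classIdealLE F p Q * JZ F G ^ (∑ i ∈ Finset.range (k + 1), m i) = ⊥ := by
    intro k
    induction k using Nat.strong_induction_on with
    | _ k ih =>
      intro hk Q hQD hQ
      have hQp : IsPGroup p Q := hD.to_le hQD
      have hJ : Ideal.jacobson (⊥ : Ideal (MonoidAlgebra F (Subgroup.center Q))) ^ m k = ⊥ :=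
        hm k hk Q hQD hQ
      have hA := augmentationSpan_range_pow_eq_bot
        (fun a b => Subtype.ext (Subgroup.mem_center_iff.1 b.2 a))
        (hQp.to_subgroup (Subgroup.center Q)) (centerToCentralizer Q) hJ
      have hstep := classIdealLE_mul_JZ_pow_le hQp hA
      rw [Finset.sum_range_succ, add_comm, pow_add, ← mul_assoc, eq_bot_iff]
      refine (mul_le_mul_left (hstep.trans (classIdealLT_le_iSup_classIdealLE p Q)) _).trans ?_
      simp only [Submodule.iSup_mul]
      refine iSup₂_le fun R hR => ?_
      obtain ⟨j, hj⟩ := (hQp.to_le hR.le).exists_card_eq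
      rw [Nat.card_eq_fintype_card] at hj
      have hjk : j < k := by
        rw [← Nat.pow_lt_pow_iff_right (Fact.out : p.Prime).one_lt, ← hj, ← hQ,
          ← Nat.card_eq_fintype_card, ← Nat.card_eq_fintype_card]
        exact Set.ncard_lt_ncard (s := (R : Set G)) (t := (Q : Set G)) hR (Set.toFinite _)
      obtain ⟨c, rfl⟩ := Nat.exists_eq_add_of_lt hjk
      rw [show j + c + 1 = (j + 1) + c by ring, Finset.sum_range_add, pow_add, ← mul_assoc,
        ih j hjk (hjk.le.trans hk) R (hR.le.trans hQD) hj, Submodule.bot_mul]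
  exact main d le_rfl D le_rfl hcard
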